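/- Define π : E(Iₙ) → ℤ by π(1_A) = |A|. Then π is a group-valued invariant mean: π(e ∨ f) = π(e) + π(f) for orthogonal idempotents e, f, and π(s⁻¹s) = π(ss⁻¹) for all s ∈ Iₙ. Moreover π is universal: for every abelian group G and every map θ : E(Iₙ) → G satisfying θ(e ∨ f) = θ(e) + θ(f) for orthogonal idempotents e, f and θ(s⁻¹s) = θ(ss⁻¹) for all s ∈ Iₙ, there is a unique group homomorphism α : ℤ → G with α ∘ π = θ. The image of the identity under π is n. -/

import Mathlib

namespace Coordinatization

/-- The data of a monoid with zero equipped with an inverse operation. -/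
structure InvMonData (S : Type) where
  mul : S → S → S
  one : S
  zero : S
  inv : S → S

variable {S T : Type}

/-- `M` is an inverse monoid with zero: a monoid with zero in which every element `a`
has a unique generalized inverse `a⁻¹`. -/
structure IsInverseMonoid (M : InvMonData S) : Prop where
  mul_assoc : ∀ a b c, M.mul (M.mul a b) c = M.mul a (M.mul b c)
  one_mul : ∀ a, M.mul M.one a = a
  mul_one : ∀ a, M.mul a M.one = a
  zero_mul : ∀ a, M.mul M.zero a = M.zero
  mul_zero : ∀ a, M.mul a M.zero = M.zero
  inv_law₁ : ∀ a, M.mul (M.mul a (M.inv a)) a = a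
  inv_law₂ : ∀ a, M.mul (M.mul (M.inv a) a) (M.inv a) = M.inv a
  inv_unique : ∀ a b, M.mul (M.mul a b) a = a → M.mul (M.mul b a) b = b → b = M.inv a

/-- `e` is an idempotent. -/
def IsIdem (M : InvMonData S) (e : S) : Prop := M.mul e e = e

/-- The natural partial order: `a ≤ b` iff `a = b·e` for some idempotent `e`. -/
def nle (M : InvMonData S) (a b : S) : Prop := ∃ e, IsIdem M e ∧ a = M.mul b e

/-- `a` and `b` are compatible: `a⁻¹b` and `ab⁻¹` are both idempotents. -/
def Compatible (M : InvMonData S) (a b : S) : Prop :=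
  IsIdem M (M.mul (M.inv a) b) ∧ IsIdem M (M.mul a (M.inv b))

/-- `a` and `b` are orthogonal: `a⁻¹b = 0 = ab⁻¹`. -/
def Orthogonal (M : InvMonData S) (a b : S) : Prop :=
  M.mul (M.inv a) b = M.zero ∧ M.mul a (M.inv b) = M.zero

/-- `j` is the join of `a` and `b` with respect to the natural partial order. -/
def IsJoin (M : InvMonData S) (a b j : S) : Prop :=
  nle M a j ∧ nle M b j ∧ ∀ c, nle M a c → nle M b c → nle M j c

/-- `m` is the meet of `a` and `b` with respect to the natural partial order. -/
def IsMeet (M : InvMonData S) (a b m : S) : Prop :=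
  nle M m a ∧ nle M m b ∧ ∀ c, nle M c a → nle M c b → nle M c m

/-- Green's relation `D`: `e D f` iff there is `a` with `a⁻¹a = e` and `aa⁻¹ = f`. -/
def DRel (M : InvMonData S) (e f : S) : Prop :=
  ∃ a, M.mul (M.inv a) a = e ∧ M.mul a (M.inv a) = f

/-- `f` is a Boolean complement of the idempotent `e` in the Boolean algebra of
idempotents: `e·f = 0` and `e ∨ f = 1`. -/
def IsComplPair (M : InvMonData S) (e f : S) : Prop :=
  IsIdem M e ∧ IsIdem M f ∧ M.mul e f = M.zero ∧ IsJoin M e f M.one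

/-- A Boolean inverse monoid: an inverse monoid with zero in which the idempotents form a
Boolean algebra under the natural partial order (meets of idempotents are given by products;
complements exist), all compatible binary joins exist, and multiplication distributes over
binary joins. -/
structure IsBooleanInverseMonoid (M : InvMonData S) : Prop where
  invMon : IsInverseMonoid M
  joins_exist : ∀ a b, Compatible M a b → ∃ j, IsJoin M a b j
  mul_join_left : ∀ c a b j, IsJoin M a b j → IsJoin M (M.mul c a) (M.mul c b) (M.mul c j)
  mul_join_right : ∀ c a b j, IsJoin M a b j → IsJoin M (M.mul a c) (M.mul b c) (M.mul j c)
  compl_exists : ∀ e, IsIdem M e → ∃ f, IsComplPair M e f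

/-- The relation `D` preserves complementation: `e D f` implies `ē D f̄`. -/
def DPreservesCompl (M : InvMonData S) : Prop :=
  ∀ e f e' f', DRel M e f → IsComplPair M e e' → IsComplPair M f f' → DRel M e' f'

/-- `M` is completely semisimple: `e D f ≤ e` implies `e = f` for idempotents. -/
def CompletelySemisimple (M : InvMonData S) : Prop :=
  ∀ e f, IsIdem M e → IsIdem M f → DRel M e f → nle M f e → e = f

/-- A Foulis monoid: a completely semisimple Boolean inverse monoid in which `D`
preserves complementation. -/
def IsFoulis (M : InvMonData S) : Prop :=
  IsBooleanInverseMonoid M ∧ CompletelySemisimple M ∧ DPreservesCompl M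

/-- The preorder underlying `S/J`: `Jle s t` iff `SsS ⊆ StS`, i.e. `s = a·t·b` for some `a, b`. -/
def Jle (M : InvMonData S) (s t : S) : Prop := ∃ a b, s = M.mul (M.mul a t) b

/-- `S/J`, the poset of principal ideals, is a lattice. -/
def LatticeCondition (M : InvMonData S) : Prop :=
  ∀ s t : S,
    (∃ m, Jle M m s ∧ Jle M m t ∧ ∀ c, Jle M c s → Jle M c t → Jle M c m) ∧
    (∃ j, Jle M s j ∧ Jle M t j ∧ ∀ c, Jle M s c → Jle M t c → Jle M j c)

/-- `[e] ⊕ [f] = [g]` in `E(S)/D`: there are orthogonal idempotents `e' D e` and `f' D f`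
whose join is `D`-related to `g`. -/
def OplusEq (M : InvMonData S) (e f g : S) : Prop :=
  ∃ e' f' j, IsIdem M e' ∧ IsIdem M f' ∧ DRel M e e' ∧ DRel M f f' ∧
    M.mul e' f' = M.zero ∧ IsJoin M e' f' j ∧ DRel M j g

/-- `M` is fundamental: only idempotents commute with every idempotent. -/
def Fundamental (M : InvMonData S) : Prop :=
  ∀ s, (∀ e, IsIdem M e → M.mul s e = M.mul e s) → IsIdem M s

/-- `M` is factorizable: every element lies beneath a unit. -/
def Factorizable (M : InvMonData S) : Prop :=
  ∀ s, ∃ g, M.mul g (M.inv g) = M.one ∧ M.mul (M.inv g) g = M.one ∧ nle M s g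

/-- All binary meets exist (`∧`-monoid). -/
def HasMeets (M : InvMonData S) : Prop := ∀ a b, ∃ m, IsMeet M a b m

/-- A morphism of Boolean inverse `∧`-monoids: a monoid homomorphism mapping zero to zero,
preserving binary compatible joins and binary meets. -/
def IsMorphism (M : InvMonData S) (N : InvMonData T) (f : S → T) : Prop :=
  f M.one = N.one ∧ f M.zero = N.zero ∧
  (∀ a b, f (M.mul a b) = N.mul (f a) (f b)) ∧
  (∀ a b j, Compatible M a b → IsJoin M a b j → IsJoin N (f a) (f b) (f j)) ∧
  (∀ a b m, IsMeet M a b m → IsMeet N (f a) (f b) (f m))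

end Coordinatization
namespace Coordinatization

/-- The symmetric inverse monoid `Iₙ` of all partial bijections of `Fin n`,
with composition as multiplication, the identity as `1`, the empty map as `0`,
and the inverse partial bijection as inversion. -/
def symData (n : ℕ) : InvMonData (PEquiv (Fin n) (Fin n)) where
  mul f g := g.trans f
  one := PEquiv.refl (Fin n)
  zero := ⊥
  inv f := f.symm

/-- Direct products of inverse monoids, with componentwise operations. -/
def piData {ι : Type} {β : ι → Type} (Ms : ∀ i, InvMonData (β i)) :
    InvMonData (∀ i, β i) where
  mul f g i := (Ms i).mul (f i) (g i)
  one i := (Ms i).one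
  zero i := (Ms i).zero
  inv f i := (Ms i).inv (f i)

/-- A semisimple inverse monoid: the finite direct product `I_{m 0} × ⋯ × I_{m (k-1)}`
of finite symmetric inverse monoids. -/
def ssData (k : ℕ) (m : Fin k → ℕ) :
    InvMonData (∀ i : Fin k, PEquiv (Fin (m i)) (Fin (m i))) :=
  piData (fun i => symData (m i))

/-- The partial identity `1_A` on a subset `A` of `Fin n`. -/
def pid {n : ℕ} (A : Finset (Fin n)) : PEquiv (Fin n) (Fin n) where
  toFun x := if x ∈ A then some x else none
  invFun x := if x ∈ A then some x else none
  inv a b := by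
    by_cases ha : a ∈ A <;> by_cases hb : b ∈ A <;>
      simp_all [Option.mem_def, eq_comm] <;> aesop

end Coordinatization
namespace Coordinatization

/-- The number of letters in the domain of a partial bijection of `Fin n` (as an integer). -/
def domCard {n : ℕ} (f : PEquiv (Fin n) (Fin n)) : ℤ :=
  (Finset.univ.filter (fun x => (f x).isSome)).card

variable {n : ℕ}

theorem pid_apply (A : Finset (Fin n)) (x : Fin n) :
    pid A x = if x ∈ A then some x else none := rfl

theorem pid_injective : Function.Injective (pid : Finset (Fin n) → _) := by
  intro A B h
  ext x
  have hx := congrArg (fun f : PEquiv (Fin n) (Fin n) => f x) h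
  by_cases hA : x ∈ A <;> by_cases hB : x ∈ B <;> simp [pid_apply, hA, hB] at hx ⊢

theorem mul_pid_apply (f : PEquiv (Fin n) (Fin n)) (A : Finset (Fin n)) (x : Fin n) :
    (symData n).mul f (pid A) x = if x ∈ A then f x else none := by
  change (pid A x).bind f = _
  by_cases h : x ∈ A <;> simp [pid_apply, h]

theorem pid_mul_pid (A B : Finset (Fin n)) :
    (symData n).mul (pid A) (pid B) = pid (A ∩ B) := by
  refine PEquiv.ext fun x => ?_
  rw [mul_pid_apply]
  by_cases hA : x ∈ A <;> by_cases hB : x ∈ B <;> simp [pid_apply, hA, hB]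

theorem isIdem_pid (A : Finset (Fin n)) : IsIdem (symData n) (pid A) := by
  rw [IsIdem, pid_mul_pid, Finset.inter_self]

theorem pid_empty : pid (∅ : Finset (Fin n)) = (symData n).zero :=
  PEquiv.ext fun x => by simp [pid_apply, symData]

theorem pid_univ : pid (Finset.univ : Finset (Fin n)) = (symData n).one :=
  PEquiv.ext fun x => by simp [pid_apply, symData]

theorem IsIdem.exists_eq_pid {e : PEquiv (Fin n) (Fin n)} (he : IsIdem (symData n) e) :
    ∃ A, e = pid A := by
  refine ⟨Finset.univ.filter fun x => (e x).isSome, PEquiv.ext fun x => ?_⟩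
  rcases hx : e x with _ | y
  · simp [pid_apply, hx]
  · have h : (e x).bind e = e x := congrArg (fun f : PEquiv (Fin n) (Fin n) => f x) he
    have hy : e y = some y := by simpa [hx] using h
    have hxy : x = y := e.inj hx hy
    simp [pid_apply, hxy, hy]

theorem nle_pid_iff {f : PEquiv (Fin n) (Fin n)} {B : Finset (Fin n)} :
    nle (symData n) f (pid B) ↔ ∃ A ⊆ B, f = pid A := by
  constructor
  · rintro ⟨e, he, rfl⟩
    obtain ⟨A, rfl⟩ := he.exists_eq_pid
    exact ⟨B ∩ A, Finset.inter_subset_left, pid_mul_pid B A⟩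
  · rintro ⟨A, hA, rfl⟩
    exact ⟨pid A, isIdem_pid A, by rw [pid_mul_pid, Finset.inter_eq_right.2 hA]⟩

theorem pid_nle_iff {f : PEquiv (Fin n) (Fin n)} {A : Finset (Fin n)} :
    nle (symData n) (pid A) f ↔ ∀ x ∈ A, f x = some x := by
  constructor
  · rintro ⟨e, he, h⟩ x hx
    obtain ⟨B, rfl⟩ := he.exists_eq_pid
    have h' := congrArg (fun g : PEquiv (Fin n) (Fin n) => g x) h
    simp only [mul_pid_apply, pid_apply, hx, if_true] at h'
    split_ifs at h' with hB
    exact h'.symm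
  · intro h
    refine ⟨pid A, isIdem_pid A, PEquiv.ext fun x => ?_⟩
    rw [mul_pid_apply, pid_apply]
    split_ifs with hx
    · exact (h x hx).symm
    · rfl

theorem isJoin_pid_union (A B : Finset (Fin n)) :
    IsJoin (symData n) (pid A) (pid B) (pid (A ∪ B)) := by
  refine ⟨nle_pid_iff.2 ⟨A, Finset.subset_union_left, rfl⟩,
    nle_pid_iff.2 ⟨B, Finset.subset_union_right, rfl⟩, fun c hA hB => ?_⟩
  rw [pid_nle_iff] at *
  intro x hx
  exact (Finset.mem_union.1 hx).elim (hA x) (hB x)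

theorem IsJoin.eq_pid_union {A B : Finset (Fin n)} {j : PEquiv (Fin n) (Fin n)}
    (h : IsJoin (symData n) (pid A) (pid B) j) : j = pid (A ∪ B) := by
  have hAB := isJoin_pid_union A B
  obtain ⟨C, hC, rfl⟩ := nle_pid_iff.1 (h.2.2 _ hAB.1 hAB.2.1)
  obtain ⟨D, hD, hCD⟩ := nle_pid_iff.1 (hAB.2.2 _ h.1 h.2.1)
  rw [hC.antisymm (pid_injective hCD ▸ hD)]

theorem pid_mul_pid_eq_zero_iff {A B : Finset (Fin n)} :
    (symData n).mul (pid A) (pid B) = (symData n).zero ↔ Disjoint A B := by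
  rw [pid_mul_pid, ← pid_empty, pid_injective.eq_iff, Finset.disjoint_iff_inter_eq_empty]

theorem domCard_pid (A : Finset (Fin n)) : domCard (pid A) = (A.card : ℤ) := by
  have h : (Finset.univ.filter fun x => (pid A x).isSome) = A := by
    ext x
    by_cases hx : x ∈ A <;> simp [pid_apply, hx]
  rw [domCard, h]

theorem inv_mul_self_eq_pid (s : PEquiv (Fin n) (Fin n)) :
    (symData n).mul ((symData n).inv s) s = pid (Finset.univ.filter fun x => (s x).isSome) := by
  refine PEquiv.ext fun x => ?_
  change (s x).bind s.symm = _
  rcases hx : s x with _ | y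
  · simp [pid_apply, hx]
  · simpa [pid_apply, hx] using s.eq_some_iff.2 hx

theorem mul_inv_self_eq_pid (s : PEquiv (Fin n) (Fin n)) :
    (symData n).mul s ((symData n).inv s) =
      pid (Finset.univ.filter fun x => (s.symm x).isSome) :=
  inv_mul_self_eq_pid s.symm

theorem domCard_symm (s : PEquiv (Fin n) (Fin n)) : domCard s.symm = domCard s := by
  refine congrArg Nat.cast (Finset.card_bij' (fun x hx => (s.symm x).get (by simpa using hx))
    (fun x hx => (s x).get (by simpa using hx)) ?_ ?_ ?_ ?_)
  · intro x hx
    obtain ⟨y, hy⟩ := Option.isSome_iff_exists.1 (Finset.mem_filter.1 hx).2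
    simp [hy, s.eq_some_iff.1 hy]
  · intro x hx
    obtain ⟨y, hy⟩ := Option.isSome_iff_exists.1 (Finset.mem_filter.1 hx).2
    simp [hy, s.eq_some_iff.2 hy]
  · intro x hx
    obtain ⟨y, hy⟩ := Option.isSome_iff_exists.1 (Finset.mem_filter.1 hx).2
    simp [hy, s.eq_some_iff.1 hy]
  · intro x hx
    obtain ⟨y, hy⟩ := Option.isSome_iff_exists.1 (Finset.mem_filter.1 hx).2
    simp [hy, s.eq_some_iff.2 hy]

/-- Any two points of `Fin n` are related by a partial bijection with singleton domain. -/
theorem dRel_pid_singleton (a b : Fin n) : DRel (symData n) (pid {a}) (pid {b}) := by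
  refine ⟨PEquiv.single a b, ?_, ?_⟩
  · rw [inv_mul_self_eq_pid]
    congr 1
    ext x
    rcases eq_or_ne x a with rfl | hx
    · simp
    · simp [PEquiv.single_apply_of_ne hx.symm, hx]
  · rw [mul_inv_self_eq_pid, PEquiv.symm_single]
    congr 1
    ext x
    rcases eq_or_ne x b with rfl | hx
    · simp
    · simp [PEquiv.single_apply_of_ne hx.symm, hx]

/-- An additive function of finite sets taking the same value on all singletons is a multiple
of cardinality. -/
theorem eq_card_nsmul_of_additive {ι G : Type*} [DecidableEq ι] [AddCommGroup G]
    (μ : Finset ι → G) (hμ : ∀ A B, Disjoint A B → μ (A ∪ B) = μ A + μ B) (g : G)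
    (hg : ∀ a, μ {a} = g) (A : Finset ι) : μ A = A.card • g := by
  induction A using Finset.induction_on with
  | empty => simpa using hμ ∅ ∅ (Finset.disjoint_empty_left _)
  | insert a A ha ih =>
    rw [Finset.insert_eq, hμ _ _ (Finset.disjoint_singleton_left.2 ha), hg, ih,
      ← Finset.insert_eq, Finset.card_insert_of_notMem ha, succ_nsmul']

/-- The map `π : E(Iₙ) → ℤ`, `π(1_A) = |A|`, is a group-valued invariant mean, it sends
the identity to `n`, and it is the universal group-valued invariant mean on `Iₙ`: every
group-valued invariant mean `θ : E(Iₙ) → G` factors through `π` via a unique group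
homomorphism `α : ℤ → G`. -/
theorem universal_invariant_mean_symmetric (n : ℕ) (hn : 1 ≤ n) :
    -- π(1_A) = |A|
    (∀ A : Finset (Fin n), domCard (pid A) = (A.card : ℤ)) ∧
    -- (GVIM1): additivity on orthogonal idempotents
    (∀ e f j, IsIdem (symData n) e → IsIdem (symData n) f →
      (symData n).mul e f = (symData n).zero → IsJoin (symData n) e f j →
      domCard j = domCard e + domCard f) ∧
    -- (GVIM2)
    (∀ s, domCard ((symData n).mul ((symData n).inv s) s) =
      domCard ((symData n).mul s ((symData n).inv s))) ∧
    -- the identity is sent to n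
    domCard (symData n).one = (n : ℤ) ∧
    -- universality
    (∀ (G : Type) [AddCommGroup G] (θ : PEquiv (Fin n) (Fin n) → G),
      (∀ e f j, IsIdem (symData n) e → IsIdem (symData n) f →
        (symData n).mul e f = (symData n).zero → IsJoin (symData n) e f j →
        θ j = θ e + θ f) →
      (∀ s, θ ((symData n).mul ((symData n).inv s) s) =
        θ ((symData n).mul s ((symData n).inv s))) →
      ∃! α : ℤ →+ G, ∀ e, IsIdem (symData n) e → α (domCard e) = θ e) := by
  refine ⟨domCard_pid, ?_, fun s => ?_, ?_, fun G _ θ hadd hinv => ?_⟩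
  · intro e f j he hf hef hj
    obtain ⟨A, rfl⟩ := he.exists_eq_pid
    obtain ⟨B, rfl⟩ := hf.exists_eq_pid
    rw [hj.eq_pid_union, domCard_pid, domCard_pid, domCard_pid,
      Finset.card_union_of_disjoint (pid_mul_pid_eq_zero_iff.1 hef), Nat.cast_add]
  · rw [inv_mul_self_eq_pid, mul_inv_self_eq_pid, domCard_pid, domCard_pid]
    exact (domCard_symm s).symm
  · rw [← pid_univ, domCard_pid, Finset.card_univ, Fintype.card_fin]
  · let a : Fin n := ⟨0, hn⟩
    have hθ : ∀ A, θ (pid A) = A.card • θ (pid {a}) := by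
      refine eq_card_nsmul_of_additive (fun A => θ (pid A)) (fun A B hAB => ?_) _ fun b => ?_
      · exact hadd _ _ _ (isIdem_pid A) (isIdem_pid B) (pid_mul_pid_eq_zero_iff.2 hAB)
          (isJoin_pid_union A B)
      · obtain ⟨s, hb, ha⟩ := dRel_pid_singleton b a
        rw [← hb, ← ha, hinv]
    refine ⟨zmultiplesHom G (θ (pid {a})), fun e he => ?_, fun α hα => ?_⟩
    · obtain ⟨A, rfl⟩ := he.exists_eq_pid
      simp [domCard_pid, hθ A]
    · ext
      simpa [domCard_pid] using hα _ (isIdem_pid {a})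

end Coordinatization
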